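/- Let n, a₁, b₁, a₂, b₂ be natural numbers with n > bᵢ ≥ aᵢ ≥ 0 and n ≥ aᵢ + bᵢ + 2 for i = 1, 2, and (a₁, b₁) ≠ (a₂, b₂). If ρ₁ is a positive real number with ρ₁^n − ρ₁^{b₁} − ρ₁^{a₁} = 0 and ρ₂ is a positive real number with ρ₂^n − ρ₂^{b₂} − ρ₂^{a₂} = 0, then ρ₁ ≠ ρ₂. -/

import Mathlib

open Polynomial in
theorem mirror_cases {p q : ℤ[X]} (hp : p.IsUnitTrinomial) (hpq : p * p.mirror = q * q.mirror) :
    q = p ∨ q = -p ∨ q = p.mirror ∨ q = -p.mirror := by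
  have hq : IsUnitTrinomial q := (isUnitTrinomial_iff'' hpq).mp hp
  obtain ⟨k, m, n, hkm, hmn, u, v, w, hp⟩ := hp
  obtain ⟨k', m', n', hkm', hmn', x, y, z, hq⟩ := hq
  have hk : k = k' := by
    rw [← mul_right_inj' (show 2 ≠ 0 from two_ne_zero), ←
      trinomial_natTrailingDegree hkm hmn u.ne_zero, ← hp, ← natTrailingDegree_mul_mirror, hpq,
      natTrailingDegree_mul_mirror, hq, trinomial_natTrailingDegree hkm' hmn' x.ne_zero]
  have hn : n = n' := by
    rw [← mul_right_inj' (show 2 ≠ 0 from two_ne_zero), ← trinomial_natDegree hkm hmn w.ne_zero, ←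
      hp, ← natDegree_mul_mirror, hpq, natDegree_mul_mirror, hq,
      trinomial_natDegree hkm' hmn' z.ne_zero]
  subst hk
  subst hn
  rcases eq_or_eq_neg_of_sq_eq_sq (y : ℤ) (v : ℤ)
      ((Int.isUnit_sq y.isUnit).trans (Int.isUnit_sq v.isUnit).symm) with
    (h1 | h1)
  · rw [h1] at hq
    rcases IsUnitTrinomial.irreducible_aux3 hkm hmn hkm' hmn' u v w x z hp hq hpq with (h2 | h2)
    · exact Or.inl h2
    · exact Or.inr (Or.inr (Or.inl h2))
  · rw [h1] at hq
    rw [trinomial_def] at hp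
    rw [← neg_inj, neg_add, neg_add, ← neg_mul, ← neg_mul, ← neg_mul, ← C_neg, ← C_neg, ← C_neg]
      at hp
    rw [← neg_mul_neg, ← mirror_neg] at hpq
    rcases IsUnitTrinomial.irreducible_aux3 hkm hmn hkm' hmn' (-u) (-v) (-w) x z hp hq hpq with
      (rfl | rfl)
    · exact Or.inr (Or.inl rfl)
    · exact Or.inr (Or.inr (Or.inr p.mirror_neg))

open Polynomial in
theorem mirror_root {K : Type*} [Field K] {p : ℤ[X]} {z : K} (hz : z ≠ 0)
    (h : aeval z p.mirror = 0) : aeval z⁻¹ p = 0 := by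
  rw [mirror, map_mul, map_pow, aeval_X] at h
  have h1 : aeval z p.reverse = 0 := by
    rcases mul_eq_zero.mp h with h | h
    · exact h
    · exact absurd h (pow_ne_zero _ hz)
  letI : Invertible z⁻¹ := invertibleOfNonzero (inv_ne_zero hz)
  have h2 := eval₂_reverse_eq_zero_iff (algebraMap ℤ K) z⁻¹ p
  rw [invOf_eq_inv, inv_inv] at h2
  exact h2.mp h1

/-- common roots of the trinomial and its reciprocal -/
theorem recip_root {N B : ℕ} {z : ℂ} (hz0 : z ≠ 0) (h1 : z ^ N = z ^ B + 1)
    (h2 : z⁻¹ ^ N = z⁻¹ ^ B + 1) :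
    (z ^ B) ^ 2 + z ^ B + 1 = 0 ∧ z ^ N = -(z ^ B) ^ 2 := by
  have hB : z ^ B ≠ 0 := pow_ne_zero _ hz0
  have hN : z ^ N ≠ 0 := pow_ne_zero _ hz0
  rw [inv_pow, inv_pow] at h2
  field_simp at h2
  generalize z ^ B = u at *
  generalize z ^ N = v at *
  subst h1
  constructor
  · linear_combination -h2
  · linear_combination -h2

open Polynomial in
theorem root_step {N B : ℕ} {z : ℂ} (hB0 : 0 < B)
    (h1 : (z ^ B) ^ 2 + z ^ B + 1 = 0) (h2 : z ^ N = -(z ^ B) ^ 2) :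
    ((z ^ Nat.gcd N B) ^ 2 - z ^ Nat.gcd N B + 1 = 0) ∧
      ((X ^ (2 * Nat.gcd N B) - X ^ Nat.gcd N B + 1 : ℤ[X]) ∣ X ^ N - X ^ B - 1) := by
  obtain ⟨B', hB'⟩ := Nat.gcd_dvd_right N B
  obtain ⟨N', hN'⟩ := Nat.gcd_dvd_left N B
  have hd : 0 < Nat.gcd N B := Nat.gcd_pos_of_pos_right _ hB0
  have h3 : (z ^ B) ^ 3 = 1 := by linear_combination (z ^ B - 1) * h1
  have h3N : (z ^ N) ^ 3 = -1 := by
    rw [h2]; linear_combination (-(z ^ B) ^ 3 - 1) * h3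
  have h6 : z ^ (6 * Nat.gcd N B) = 1 := by
    rw [← orderOf_dvd_iff_pow_eq_one, ← Nat.gcd_mul_left]
    apply Nat.dvd_gcd
    · rw [orderOf_dvd_iff_pow_eq_one, mul_comm, pow_mul]
      linear_combination ((z ^ N) ^ 3 - 1) * h3N
    · rw [orderOf_dvd_iff_pow_eq_one, mul_comm, pow_mul]
      linear_combination ((z ^ B) ^ 3 + 1) * h3
  generalize Nat.gcd N B = d at *
  subst hB' hN'
  rw [mul_comm, pow_mul] at h6
  rw [pow_mul] at h1 h2 h3 h3N
  rw [pow_mul] at h2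
  generalize z ^ d = w at *
  have hw3 : w ^ 3 = -1 := by
    have : (w ^ 3 - 1) * (w ^ 3 + 1) = 0 := by linear_combination h6
    rcases mul_eq_zero.mp this with h | h
    · exfalso
      have : w ^ 3 = 1 := by linear_combination h
      rw [← pow_mul, mul_comm, pow_mul, this, one_pow] at h3N
      norm_num at h3N
    · linear_combination h
  have hw : w ^ 2 - w + 1 = 0 := by
    have : (w + 1) * (w ^ 2 - w + 1) = 0 := by linear_combination hw3
    rcases mul_eq_zero.mp this with h | h
    · exfalso
      have : w = -1 := by linear_combination h
      rw [this] at h1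
      rcases neg_one_pow_eq_or ℂ B' with h | h <;> rw [h] at h1 <;> norm_num at h1
    · exact h
  have hprim : IsPrimitiveRoot w 6 := by
    haveI : NeZero ((6 : ℕ) : ℂ) := ⟨by norm_num⟩
    rw [← isRoot_cyclotomic_iff, cyclotomic_six]
    simpa using hw
  have hdvd : cyclotomic 6 ℤ ∣ X ^ N' - X ^ B' - 1 := by
    rw [cyclotomic_eq_minpoly hprim (by norm_num)]
    apply minpoly.isIntegrallyClosed_dvd (hprim.isIntegral (by norm_num))
    simp only [map_sub, map_pow, aeval_X, map_one]
    linear_combination h2 - h1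
  refine ⟨hw, ?_⟩
  have := map_dvd (expand ℤ d) hdvd
  rw [cyclotomic_six] at this
  simpa [← pow_mul, mul_comm] using this

open Polynomial in
theorem key {N B : ℕ} (hB0 : 0 < B) (hBN : B < N) {ρ : ℝ} (hρ : 1 < ρ) (h : ρ ^ N = ρ ^ B + 1) :
    ∃ k : ℤ[X], X ^ N - X ^ B - 1 = minpoly ℤ ρ * k ∧
      (k = 1 ∨ ∃ d, 0 < d ∧ d ∣ N ∧ d ∣ B ∧ k = X ^ (2 * d) - X ^ d + 1) := by
  have htri : (X ^ N - X ^ B - 1 : ℤ[X]) = trinomial 0 B N ((-1 : ℤˣ) : ℤ) ((-1 : ℤˣ) : ℤ)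
      ((1 : ℤˣ) : ℤ) := by
    rw [trinomial_def]; simp; ring
  have hmon : (X ^ N - X ^ B - 1 : ℤ[X]).Monic := by
    rw [htri]; exact trinomial_monic hB0 hBN
  have hut : (X ^ N - X ^ B - 1 : ℤ[X]).IsUnitTrinomial := ⟨0, B, N, hB0, hBN, -1, -1, 1, htri⟩
  have hroot : aeval ρ (X ^ N - X ^ B - 1 : ℤ[X]) = 0 := by
    simp only [map_sub, map_pow, aeval_X, map_one]; linarith
  have hint : IsIntegral ℤ ρ := ⟨_, hmon, hroot⟩
  obtain ⟨k, hk⟩ := minpoly.isIntegrallyClosed_dvd hint hroot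
  have hgm := minpoly.monic hint
  have hgi := minpoly.prime_of_isIntegrallyClosed hint
  have hg0 := minpoly.aeval ℤ ρ
  generalize hg : minpoly ℤ ρ = g at *
  have hkm : k.Monic := hgm.of_mul_monic_left (hk ▸ hmon)
  refine ⟨k, hk, ?_⟩
  -- `k` is self-reciprocal
  have hmir : k.mirror = k ∨ k.mirror = -k := by
    have hq := mirror_cases hut (q := g * k.mirror) (by
      rw [hk, mirror_mul_of_domain, mirror_mul_of_domain, mirror_mirror]; ring)
    have hq0 : aeval ρ (g * k.mirror) = 0 := by rw [map_mul, hg0, zero_mul]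
    have hne : aeval ρ (X ^ N - X ^ B - 1 : ℤ[X]).mirror ≠ 0 := by
      intro hc
      have := mirror_root (by positivity) hc
      simp only [map_sub, map_pow, aeval_X, map_one] at this
      have h1 : ρ⁻¹ ^ N ≤ 1 := pow_le_one₀ (by positivity) (inv_le_one_of_one_le₀ hρ.le)
      have h2 : 0 < ρ⁻¹ ^ B := by positivity
      linarith
    rcases hq with hq | hq | hq | hq
    · left; rw [hk] at hq; exact mul_left_cancel₀ hgm.ne_zero hq
    · right; rw [hk, ← mul_neg] at hq; exact mul_left_cancel₀ hgm.ne_zero hq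
    · rw [hq] at hq0; exact absurd hq0 hne
    · rw [hq, map_neg, neg_eq_zero] at hq0; exact absurd hq0 hne
  have hfz : ∀ z : ℂ, aeval z k = 0 → z ^ N = z ^ B + 1 := by
    intro z hz
    have : aeval z (X ^ N - X ^ B - 1 : ℤ[X]) = 0 := by rw [hk, map_mul, hz, mul_zero]
    simp only [map_sub, map_pow, aeval_X, map_one] at this
    linear_combination this
  have hkz : ∀ z : ℂ, aeval z k = 0 →
      z ≠ 0 ∧ (z ^ B) ^ 2 + z ^ B + 1 = 0 ∧ z ^ N = -(z ^ B) ^ 2 := by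
    intro z hz
    have h1 := hfz z hz
    have hz0 : z ≠ 0 := by
      rintro rfl
      rw [zero_pow (by omega), zero_pow (by omega)] at h1
      norm_num at h1
    have hm : aeval z k.mirror = 0 := by
      rcases hmir with h | h <;> rw [h] <;> simp [hz]
    exact ⟨hz0, recip_root hz0 h1 (hfz _ (mirror_root hz0 hm))⟩
  have hex : ∀ p : ℤ[X], p.Monic → p ≠ 1 → ∃ z : ℂ, aeval z p = 0 := by
    intro p hp hp1
    have hdeg : 0 < p.natDegree := Nat.pos_of_ne_zero fun h => hp1 (hp.natDegree_eq_zero.mp h)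
    obtain ⟨z, hz⟩ := IsAlgClosed.exists_aeval_eq_zero ℂ p (by
      intro h0
      rw [natDegree_eq_of_degree_eq_some h0] at hdeg
      exact lt_irrefl _ hdeg)
    exact ⟨z, hz⟩
  by_cases hk1 : k = 1
  · exact Or.inl hk1
  right
  obtain ⟨z, hz⟩ := hex k hkm hk1
  obtain ⟨hz0, hz1, hz2⟩ := hkz z hz
  have hdvd := (root_step hB0 hz1 hz2).2
  have hroots := fun y hy1 hy2 => (root_step (z := y) (N := N) hB0 hy1 hy2).1
  obtain ⟨d, hde⟩ : ∃ d, d = Nat.gcd N B := ⟨_, rfl⟩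
  have hd : 0 < d := hde ▸ Nat.gcd_pos_of_pos_right _ hB0
  have hdN : d ∣ N := hde ▸ Nat.gcd_dvd_left _ _
  have hdB : d ∣ B := hde ▸ Nat.gcd_dvd_right _ _
  rw [← hde] at hdvd hroots
  refine ⟨d, hd, hdN, hdB, ?_⟩
  rw [hk] at hdvd
  have hΦm : (X ^ (2 * d) - X ^ d + 1 : ℤ[X]).Monic := by
    have := (trinomial_monic (R := ℤ) (u := 1) (v := -1) hd (by omega : d < 2 * d))
    convert this using 1
    rw [trinomial_def]; simp; ring
  have hnd : ¬ g ∣ (X ^ (2 * d) - X ^ d + 1 : ℤ[X]) := by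
    rintro ⟨r, hr⟩
    have := congrArg (aeval ρ) hr
    rw [map_mul, hg0, zero_mul] at this
    simp only [map_sub, map_add, map_pow, aeval_X, map_one] at this
    rw [mul_comm, pow_mul] at this
    nlinarith [sq_nonneg (ρ ^ d - 1), sq_nonneg (ρ ^ d)]
  obtain ⟨s, hs⟩ := hdvd
  obtain ⟨t, rfl⟩ := (hgi.dvd_or_dvd ⟨k, hs.symm⟩).resolve_left hnd
  have hk2 : k = (X ^ (2 * d) - X ^ d + 1) * t := by
    apply mul_left_cancel₀ hgm.ne_zero
    rw [hs]; ring
  have htm : t.Monic := hΦm.of_mul_monic_left (hk2 ▸ hkm)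
  by_cases ht : t = 1
  · rw [hk2, ht, mul_one]
  exfalso
  obtain ⟨y, hy⟩ := hex t htm ht
  have hyk : aeval y k = 0 := by rw [hk2, map_mul, hy, mul_zero]
  obtain ⟨hy0, hy1, hy2⟩ := hkz y hyk
  have hy3 : (y ^ B) ^ 3 = 1 := by linear_combination (y ^ B - 1) * hy1
  have hnorm : ‖y‖ = 1 := by
    rw [← pow_mul] at hy3
    exact Complex.norm_eq_one_of_pow_eq_one hy3 (by omega)
  have hyΦ : aeval y (X ^ (2 * d) - X ^ d + 1 : ℤ[X]) = 0 := by
    have := hroots y hy1 hy2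
    simp only [map_sub, map_add, map_pow, aeval_X, map_one]
    rw [mul_comm, pow_mul]; exact this
  have hder := congrArg (fun p => aeval y (derivative p)) hk
  simp only [hk2, derivative_mul, map_add, map_mul, hy, hyΦ, mul_zero, zero_mul, add_zero,
    derivative_sub, derivative_X_pow, derivative_one, map_sub, map_pow, aeval_X, map_zero,
    sub_zero, aeval_C] at hder
  have hder2 : (N : ℂ) * y ^ N = B * y ^ B := by
    have hN : y ^ N = y ^ (N - 1) * y := by rw [← pow_succ, Nat.sub_add_cancel (by omega)]
    have hB : y ^ B = y ^ (B - 1) * y := by rw [← pow_succ, Nat.sub_add_cancel (by omega)]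
    simp at hder
    rw [hN, hB]; linear_combination y * hder
  have := congrArg norm hder2
  simp [hnorm] at this
  omega

set_option maxHeartbeats 2000000 in
open Polynomial in
theorem final_case {N B a b : ℕ} (ha : 0 < a) (hab : a < b) (hbB : b < B) (hBN : B + 2 ≤ N)
    (hN : a + b + 2 ≤ N) {ρ : ℝ} (hρ : 1 < ρ) (h1 : ρ ^ N = ρ ^ B + 1)
    (h2 : ρ ^ N = ρ ^ b + ρ ^ a) : False := by
  have h2' : ρ ^ (N - a) = ρ ^ (b - a) + 1 := by
    have h0 : ρ ^ a ≠ 0 := by positivity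
    apply mul_left_cancel₀ h0
    rw [mul_add, ← pow_add, ← pow_add, mul_one, show a + (N - a) = N by omega,
      show a + (b - a) = b by omega, h2]
  obtain ⟨k1, e1, c1⟩ := key (by omega) (by omega) hρ h1
  obtain ⟨k2, e2, c2⟩ := key (by omega) (by omega) hρ h2'
  have e : (X ^ N - X ^ B - 1) * k2 = (X ^ (N - a) - X ^ (b - a) - 1) * k1 := by
    rw [e1, e2]; ring
  have dg : ∀ {m c : ℕ}, 0 < c → c < m → (X ^ m - X ^ c - 1 : ℤ[X]).Monic ∧
      (X ^ m - X ^ c - 1 : ℤ[X]).natDegree = m := by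
    intro m c hc hm
    have : (X ^ m - X ^ c - 1 : ℤ[X]) = trinomial 0 c m (-1) (-1) 1 := by
      rw [trinomial_def]; simp; ring
    rw [this]
    exact ⟨trinomial_monic hc hm, trinomial_natDegree hc hm one_ne_zero⟩
  have dk : ∀ {d : ℕ}, 0 < d → (X ^ (2 * d) - X ^ d + 1 : ℤ[X]).Monic ∧
      (X ^ (2 * d) - X ^ d + 1 : ℤ[X]).natDegree = 2 * d := by
    intro d hd
    have : (X ^ (2 * d) - X ^ d + 1 : ℤ[X]) = trinomial 0 d (2 * d) 1 (-1) 1 := by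
      rw [trinomial_def]; simp; ring
    rw [this]
    exact ⟨trinomial_monic hd (by omega), trinomial_natDegree hd (by omega) one_ne_zero⟩
  obtain ⟨m1, d1⟩ := dg (by omega : 0 < B) (by omega : B < N)
  obtain ⟨m2, d2⟩ := dg (by omega : 0 < b - a) (by omega : b - a < N - a)
  have ed := congrArg natDegree e
  rcases c1 with rfl | ⟨d, hd, hdN, hdB, rfl⟩
  · rcases c2 with rfl | ⟨d', hd', hdN', hdB', rfl⟩
    · rw [mul_one, mul_one, d1, d2] at ed; omega
    · rw [mul_one, m1.natDegree_mul (dk hd').1, d1, d2, (dk hd').2] at ed; omega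
  have hdNB : d ≤ N - B := Nat.le_of_dvd (by omega) (Nat.dvd_sub hdN hdB)
  rcases c2 with rfl | ⟨d', hd', hdN', hdB', rfl⟩
  · rw [mul_one, m2.natDegree_mul (dk hd).1, d1, d2, (dk hd).2] at ed
    have hexp : (X ^ N - X ^ B - X ^ 0 : ℤ[X]) = X ^ (N - a + 2 * d) - X ^ (N - a + d) + X ^ (N - a)
        - X ^ (b - a + 2 * d) + X ^ (b - a + d) - X ^ (b - a) - X ^ (2 * d) + X ^ d - X ^ 0 := by
      linear_combination e
    have hB : B = N - d := by
      by_contra hB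
      have k1 := congrArg (fun p => coeff p (N - d)) hexp
      simp only [coeff_sub, coeff_add, coeff_X_pow] at k1
      rw [if_neg (by omega : ¬ N - d = N), if_neg (by omega : ¬ N - d = B), if_pos (by omega : N - d = N - a + d),
        if_neg (by omega : ¬ N - d = N - a + 2 * d), if_neg (by omega : ¬ N - d = N - a), if_neg (by omega : ¬ N - d = b - a + 2 * d), if_neg (by omega : ¬ N - d = b - a + d), if_neg (by omega : ¬ N - d = b - a), if_neg (by omega : ¬ N - d = 2 * d), if_neg (by omega : ¬ N - d = d), if_neg (by omega : ¬ N - d = 0)] at k1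
      norm_num at k1
    have k2 := congrArg (fun p => coeff p (N - a)) hexp
    simp only [coeff_sub, coeff_add, coeff_X_pow] at k2
    rw [if_neg (by omega : ¬ N - a = N), if_neg (by omega : ¬ N - a = B), if_pos True.intro,
      if_neg (by omega : ¬ N - a = N - a + 2 * d), if_neg (by omega : ¬ N - a = N - a + d), if_neg (by omega : ¬ N - a = b - a + 2 * d), if_neg (by omega : ¬ N - a = b - a + d), if_neg (by omega : ¬ N - a = b - a), if_neg (by omega : ¬ N - a = 2 * d), if_neg (by omega : ¬ N - a = d), if_neg (by omega : ¬ N - a = 0)] at k2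
    norm_num at k2
  · rw [m1.natDegree_mul (dk hd').1, m2.natDegree_mul (dk hd).1, d1, d2, (dk hd).2,
      (dk hd').2] at ed
    have hdc : d' ≤ b - a := Nat.le_of_dvd (by omega) hdB'
    have hexp : (X ^ (N + 2 * d') - X ^ (N + d') + X ^ N - X ^ (B + 2 * d') + X ^ (B + d') - X ^ B
        - X ^ (2 * d') + X ^ d' - X ^ 0 : ℤ[X]) =
        X ^ (N - a + 2 * d) - X ^ (N - a + d) + X ^ (N - a)
        - X ^ (b - a + 2 * d) + X ^ (b - a + d) - X ^ (b - a) - X ^ (2 * d) + X ^ d - X ^ 0 := by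
      linear_combination e
    have k1 := congrArg (fun p => coeff p (N + d')) hexp
    simp only [coeff_sub, coeff_add, coeff_X_pow] at k1
    rw [if_neg (by omega : ¬ N + d' = N + 2 * d'), if_pos True.intro, if_neg (by omega : ¬ N + d' = N),
      if_neg (by omega : ¬ N + d' = B + 2 * d'), if_neg (by omega : ¬ N + d' = B + d'),
      if_neg (by omega : ¬ N + d' = B), if_neg (by omega : ¬ N + d' = 2 * d'),
      if_neg (by omega : ¬ N + d' = d'), if_neg (by omega : ¬ N + d' = 0)] at k1
    rw [if_neg (by omega : ¬ N + d' = N - a + 2 * d), if_neg (by omega : ¬ N + d' = N - a + d), if_neg (by omega : ¬ N + d' = N - a), if_neg (by omega : ¬ N + d' = b - a + 2 * d), if_neg (by omega : ¬ N + d' = b - a), if_neg (by omega : ¬ N + d' = 2 * d), if_neg (by omega : ¬ N + d' = d)] at k1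
    split_ifs at k1 <;> norm_num at k1

theorem equal_case {N B a : ℕ} (hB0 : 0 < B) (hBN : B + 2 ≤ N) (hN : a < N)
    {ρ : ℝ} (hρ : 1 < ρ) (h1 : ρ ^ N = ρ ^ B + 1)
    (h2 : ρ ^ N = ρ ^ a + ρ ^ a) : False := by
  have h2' : ρ ^ (N - a) = 2 := by
    have h0 : ρ ^ a ≠ 0 := by positivity
    apply mul_left_cancel₀ h0
    rw [← pow_add, show a + (N - a) = N by omega, h2]; ring
  have hint : IsIntegral ℤ ρ := by
    refine IsIntegral.of_pow (n := N - a) (by omega) ?_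
    rw [h2']; exact isIntegral_algebraMap (R := ℤ) (x := 2) 
  have hinv : ρ⁻¹ = ρ ^ (N - 1) - ρ ^ (B - 1) := by
    have h0 : ρ ≠ 0 := by positivity
    apply mul_left_cancel₀ h0
    rw [mul_sub, ← pow_succ', ← pow_succ', show N - 1 + 1 = N by omega,
      show B - 1 + 1 = B by omega, h1, mul_inv_cancel₀ h0]; ring
  have hint' : IsIntegral ℤ ρ⁻¹ := by
    rw [hinv]; exact (hint.pow _).sub (hint.pow _)
  have h3 := hint'.pow (N - a)
  rw [inv_pow, h2'] at h3
  have h4 : IsIntegral ℤ ((1 / 2 : ℚ)) := by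
    have : ((2 : ℝ)⁻¹) = algebraMap ℚ ℝ (1 / 2) := by simp
    rw [this] at h3
    exact (isIntegral_algebraMap_iff (algebraMap ℚ ℝ).injective).mp h3
  obtain ⟨m, hm⟩ := IsIntegrallyClosed.isIntegral_iff.mp h4
  have h5 : ((2 * m : ℤ) : ℚ) = (1 : ℤ) := by
    push_cast
    have : (m : ℚ) = 1 / 2 := by simpa using hm
    rw [this]; norm_num
  have h6 : 2 * m = 1 := by exact_mod_cast h5
  omega

theorem gt_one {n a b : ℕ} (hb : b < n) {ρ : ℝ} (hρ : 0 < ρ) (h : ρ ^ n - ρ ^ b - ρ ^ a = 0) :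
    1 < ρ := by
  by_contra hc
  have h1 : ρ ^ n ≤ ρ ^ b := pow_le_pow_of_le_one hρ.le (not_lt.mp hc) hb.le
  have h2 : 0 < ρ ^ a := by positivity
  linarith

theorem main_case (n a₁ b₁ a₂ b₂ : ℕ)
    (hn₁ : a₁ + b₁ + 2 ≤ n) (hab₂ : a₂ ≤ b₂) (hn₂ : a₂ + b₂ + 2 ≤ n)
    (hlt : b₂ < b₁) (ρ : ℝ) (hρ : 1 < ρ)
    (h₁ : ρ ^ n - ρ ^ b₁ - ρ ^ a₁ = 0)
    (h₂ : ρ ^ n - ρ ^ b₂ - ρ ^ a₂ = 0) : False := by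
  have hlt' : ρ ^ b₂ < ρ ^ b₁ := pow_lt_pow_right₀ hρ hlt
  have ha : a₁ < a₂ := (pow_lt_pow_iff_right₀ hρ).mp (by linarith)
  have h0 : ρ ^ a₁ ≠ 0 := by positivity
  have e1 : ρ ^ (n - a₁) = ρ ^ (b₁ - a₁) + 1 := by
    apply mul_left_cancel₀ h0
    rw [mul_add, ← pow_add, ← pow_add, mul_one, show a₁ + (n - a₁) = n by omega,
      show a₁ + (b₁ - a₁) = b₁ by omega]; linarith
  have e2 : ρ ^ (n - a₁) = ρ ^ (b₂ - a₁) + ρ ^ (a₂ - a₁) := by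
    apply mul_left_cancel₀ h0
    rw [mul_add, ← pow_add, ← pow_add, ← pow_add, show a₁ + (n - a₁) = n by omega,
      show a₁ + (b₂ - a₁) = b₂ by omega, show a₁ + (a₂ - a₁) = a₂ by omega]; linarith
  rcases hab₂.eq_or_lt with h | h
  · subst h
    exact equal_case (by omega) (by omega) (by omega) hρ e1 e2
  · exact final_case (by omega) (by omega) (by omega) (by omega) (by omega) hρ e1 e2

/-- Positive roots of distinct θ-digraph characteristic polynomials of the
same degree are distinct. -/
theorem theta_spectral_radii_distinct (n a₁ b₁ a₂ b₂ : ℕ)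
    (hab₁ : a₁ ≤ b₁) (hbn₁ : b₁ < n) (hn₁ : a₁ + b₁ + 2 ≤ n)
    (hab₂ : a₂ ≤ b₂) (hbn₂ : b₂ < n) (hn₂ : a₂ + b₂ + 2 ≤ n)
    (hne : (a₁, b₁) ≠ (a₂, b₂))
    (ρ₁ ρ₂ : ℝ) (hρ₁ : 0 < ρ₁) (hρ₂ : 0 < ρ₂)
    (h₁ : ρ₁ ^ n - ρ₁ ^ b₁ - ρ₁ ^ a₁ = 0)
    (h₂ : ρ₂ ^ n - ρ₂ ^ b₂ - ρ₂ ^ a₂ = 0) :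
    ρ₁ ≠ ρ₂ := by
  rintro rfl
  have hρ := gt_one hbn₁ hρ₁ h₁
  rcases lt_trichotomy b₁ b₂ with h | h | h
  · exact main_case n a₂ b₂ a₁ b₁ hn₂ hab₁ hn₁ h ρ₁ hρ h₂ h₁
  · subst h
    have : ρ₁ ^ a₁ = ρ₁ ^ a₂ := by linarith
    have := pow_right_injective₀ hρ₁ hρ.ne' this
    exact hne (by rw [this])
  · exact main_case n a₁ b₁ a₂ b₂ hn₁ hab₂ hn₂ h ρ₁ hρ h₁ h₂
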